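/- Let n be a positive integer, K ⊆ ℝⁿ compact and U ⊆ ℝⁿ open with K ⊆ U. Then there exist an infinitely differentiable function ζ : ℝⁿ → ℝ with compact support contained in U and a constant C > 0 such that 0 ≤ ζ(x) ≤ 1 for all x, ζ(x) = 1 for all x ∈ K, and ‖∇ζ(x)‖² ≤ C·ζ(x) for all x ∈ ℝⁿ. -/

import Mathlib

/-- If `f` has bounded derivative, then `f ^ 2` satisfies `‖∇(f ^ 2)‖² ≤ 4 M² f ^ 2`. -/
lemma norm_fderiv_sq_sq_le {E : Type*} [NormedAddCommGroup E] [NormedSpace ℝ E] {f : E → ℝ}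
    {x : E} {M : ℝ} (hf : DifferentiableAt ℝ f x) (hM : ‖fderiv ℝ f x‖ ≤ M) :
    ‖fderiv ℝ (fun y => f y ^ 2) x‖ ^ 2 ≤ 4 * M ^ 2 * f x ^ 2 := by
  have h : fderiv ℝ (fun y => f y ^ 2) x = (2 * f x) • fderiv ℝ f x := by
    simpa using (hf.hasFDerivAt.pow 2).fderiv
  rw [h, norm_smul, mul_pow, Real.norm_eq_abs, sq_abs]
  calc (2 * f x) ^ 2 * ‖fderiv ℝ f x‖ ^ 2 ≤ (2 * f x) ^ 2 * M ^ 2 := by gcongr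
    _ = 4 * M ^ 2 * f x ^ 2 := by ring

/-- Existence of a smooth cutoff `ζ ∈ C₀^∞(U)` with `ζ = 1` on `K`, `0 ≤ ζ ≤ 1`,
and `‖∇ζ‖² ≤ Cζ`. -/
theorem stmt6 (n : ℕ) (hn : 0 < n) (K U : Set (EuclideanSpace ℝ (Fin n)))
    (hK : IsCompact K) (hU : IsOpen U) (hKU : K ⊆ U) :
    ∃ (ζ : EuclideanSpace ℝ (Fin n) → ℝ) (C : ℝ), 0 < C ∧
      ContDiff ℝ (⊤ : ℕ∞) ζ ∧ HasCompactSupport ζ ∧ tsupport ζ ⊆ U ∧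
      (∀ x, 0 ≤ ζ x ∧ ζ x ≤ 1) ∧ (∀ x ∈ K, ζ x = 1) ∧
      (∀ x, ‖fderiv ℝ ζ x‖ ^ 2 ≤ C * ζ x) := by
  obtain ⟨L, hL, hKL, hLU⟩ := exists_compact_between hK hU hKU
  obtain ⟨η, hη, hrange, hsupp, hone⟩ := exists_contMDiff_support_eq_eq_one_iff
    (modelWithCornersSelf ℝ (EuclideanSpace ℝ (Fin n))) isOpen_interior hK.isClosed hKL
  have hη' : ContDiff ℝ (⊤ : ℕ∞) η := hη.contDiff
  have h01 : ∀ x, 0 ≤ η x ∧ η x ≤ 1 := fun x => hrange ⟨x, rfl⟩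
  have htsupp : tsupport η ⊆ L :=
    closure_minimal (hsupp.trans_subset interior_subset) hL.isClosed
  have hcomp : HasCompactSupport η := hL.of_isClosed_subset (isClosed_tsupport η) htsupp
  obtain ⟨M, hM⟩ := (hcomp.fderiv ℝ).exists_bound_of_continuous (hη'.continuous_fderiv (by simp))
  have hsq : tsupport (fun x => η x ^ 2) ⊆ tsupport η :=
    closure_mono fun x hx h => hx (by simp [h])
  refine ⟨fun x => η x ^ 2, 4 * M ^ 2 + 1, by positivity, hη'.pow 2,
    hcomp.of_isClosed_subset (isClosed_tsupport _) hsq, hsq.trans (htsupp.trans hLU),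
    fun x => ⟨sq_nonneg _, pow_le_one₀ (h01 x).1 (h01 x).2⟩,
    fun x hx => by simp [(hone x).1 hx], fun x => ?_⟩
  have h := norm_fderiv_sq_sq_le (hη'.differentiable (by simp) x) (hM x)
  nlinarith [sq_nonneg (η x)]
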